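/- Let n be a positive integer. The orbits of the SL₂(ℤ)-action on (ℤ/nℤ)² \ {(0,0)} are in bijection, via the invariant g(p,q) = gcd(p̃, gcd(q̃, n)) (where p̃, q̃ ∈ {0,…,n−1} are the canonical integer representatives), with the positive divisors d of n satisfying d < n. In particular, the number of orbits on the set of nonzero pairs equals the number of positive divisors of n minus one. -/

import Mathlib

/-- The action of `SL₂(ℤ)` on `(ℤ/nℤ)²`: reduce the matrix entries modulo `n` and
multiply the column vector `(v.1, v.2)`. -/
def sl2Smul (n : ℕ) (M : Matrix.SpecialLinearGroup (Fin 2) ℤ) (v : ZMod n × ZMod n) :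
    ZMod n × ZMod n :=
  (((M.1 0 0 : ℤ) : ZMod n) * v.1 + ((M.1 0 1 : ℤ) : ZMod n) * v.2,
   ((M.1 1 0 : ℤ) : ZMod n) * v.1 + ((M.1 1 1 : ℤ) : ZMod n) * v.2)

/-- `g(p,q) = gcd(p̃, gcd(q̃, n))`, where `p̃, q̃ ∈ {0,…,n−1}` are the canonical
integer representatives of `p` and `q`. -/
def gInv (n : ℕ) (v : ZMod n × ZMod n) : ℕ :=
  Nat.gcd v.1.val (Nat.gcd v.2.val n)

lemma sl2Smul_one (n : ℕ) (v : ZMod n × ZMod n) : sl2Smul n 1 v = v := by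
  simp [sl2Smul, Matrix.SpecialLinearGroup.coe_one, Matrix.one_apply]

lemma sl2Smul_mul (n : ℕ) (M N : Matrix.SpecialLinearGroup (Fin 2) ℤ)
    (v : ZMod n × ZMod n) :
    sl2Smul n (M * N) v = sl2Smul n M (sl2Smul n N v) := by
  simp only [sl2Smul, Matrix.SpecialLinearGroup.coe_mul, Matrix.mul_apply,
    Fin.sum_univ_two]
  refine Prod.ext ?_ ?_ <;> push_cast <;> ring

/-- Two nonzero elements of `(ℤ/nℤ)²` are equivalent if they lie in the same orbit of
the `SL₂(ℤ)`-action (which fixes `(0,0)`, hence restricts to nonzero pairs). -/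
def sl2OrbitSetoidNonzero (n : ℕ) :
    Setoid {v : ZMod n × ZMod n // v ≠ ((0 : ZMod n), (0 : ZMod n))} where
  r v w := ∃ M : Matrix.SpecialLinearGroup (Fin 2) ℤ, sl2Smul n M v.1 = w.1
  iseqv := by
    refine ⟨fun v => ⟨1, sl2Smul_one n v.1⟩, ?_, ?_⟩
    · rintro v w ⟨M, h⟩
      exact ⟨M⁻¹, by rw [← h, ← sl2Smul_mul, inv_mul_cancel, sl2Smul_one]⟩
    · rintro v w u ⟨M, hM⟩ ⟨N, hN⟩
      exact ⟨N * M, by rw [sl2Smul_mul, hM, hN]⟩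

lemma gInv_intCast (n : ℕ) [NeZero n] (a b : ℤ) :
    gInv n ((a : ZMod n), (b : ZMod n)) = Nat.gcd (Int.gcd a b) n := by
  have val_dvd (d : ℕ) (hd : d ∣ n) (x : ℤ) : d ∣ (x : ZMod n).val ↔ (d : ℤ) ∣ x := by
    rw [← Int.natCast_dvd_natCast, ZMod.val_intCast]
    exact EuclideanDomain.dvd_mod_iff (Int.natCast_dvd_natCast.mpr hd)
  have dvd_iff (d : ℕ) :
      d ∣ gInv n ((a : ZMod n), (b : ZMod n)) ↔ d ∣ Nat.gcd (Int.gcd a b) n := by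
    simp only [gInv, Nat.dvd_gcd_iff, Int.dvd_gcd_iff]
    constructor
    · rintro ⟨ha, hb, hd⟩
      exact ⟨⟨(val_dvd d hd a).mp ha, (val_dvd d hd b).mp hb⟩, hd⟩
    · rintro ⟨⟨ha, hb⟩, hd⟩
      exact ⟨(val_dvd d hd a).mpr ha, (val_dvd d hd b).mpr hb, hd⟩
  exact Nat.dvd_antisymm ((dvd_iff _).mp dvd_rfl) ((dvd_iff _).mpr dvd_rfl)

lemma exists_intCast_pair (n : ℕ) (v : ZMod n × ZMod n) :
    ∃ a b : ℤ, v = ((a : ZMod n), (b : ZMod n)) := by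
  obtain ⟨a, ha⟩ := ZMod.intCast_surjective v.1
  obtain ⟨b, hb⟩ := ZMod.intCast_surjective v.2
  exact ⟨a, b, Prod.ext ha.symm hb.symm⟩

lemma gInv_dvd_gInv_sl2Smul (n : ℕ) [NeZero n] (M : Matrix.SpecialLinearGroup (Fin 2) ℤ)
    (v : ZMod n × ZMod n) : gInv n v ∣ gInv n (sl2Smul n M v) := by
  obtain ⟨a, b, rfl⟩ := exists_intCast_pair n v
  have h : sl2Smul n M ((a : ZMod n), (b : ZMod n)) =
      (((M.1 0 0 * a + M.1 0 1 * b : ℤ) : ZMod n), ((M.1 1 0 * a + M.1 1 1 * b : ℤ) : ZMod n)) := by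
    simp [sl2Smul]
  rw [h, gInv_intCast, gInv_intCast]
  refine Nat.gcd_dvd_gcd_of_dvd_left n (Int.dvd_gcd ?_ ?_)
  all_goals exact dvd_add ((Int.gcd_dvd_left a b).mul_left _) ((Int.gcd_dvd_right a b).mul_left _)

lemma gInv_sl2Smul (n : ℕ) [NeZero n] (M : Matrix.SpecialLinearGroup (Fin 2) ℤ)
    (v : ZMod n × ZMod n) : gInv n (sl2Smul n M v) = gInv n v := by
  refine Nat.dvd_antisymm ?_ (gInv_dvd_gInv_sl2Smul n M v)
  have h := gInv_dvd_gInv_sl2Smul n M⁻¹ (sl2Smul n M v)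
  rwa [← sl2Smul_mul, inv_mul_cancel, sl2Smul_one] at h

lemma exists_sl2Smul_intCast_eq_gcd (n : ℕ) (a b : ℤ) :
    ∃ M : Matrix.SpecialLinearGroup (Fin 2) ℤ,
      sl2Smul n M ((a : ZMod n), (b : ZMod n)) = ((Int.gcd a b : ZMod n), 0) := by
  rcases Nat.eq_zero_or_pos (Int.gcd a b) with h | h
  · obtain ⟨rfl, rfl⟩ := Int.gcd_eq_zero_iff.mp h
    exact ⟨1, by simp [sl2Smul_one]⟩
  obtain ⟨x, hx⟩ := Int.gcd_dvd_left a b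
  obtain ⟨y, hy⟩ := Int.gcd_dvd_right a b
  have hg : (Int.gcd a b : ℤ) ≠ 0 := by exact_mod_cast h.ne'
  have bezout := Int.gcd_eq_gcd_ab a b
  set g : ℤ := ((Int.gcd a b : ℕ) : ℤ)
  set s := Int.gcdA a b
  set t := Int.gcdB a b
  have hdet : s * x + t * y = 1 := by
    apply mul_left_cancel₀ hg
    linear_combination -bezout - s * hx - t * hy
  have hrow : -y * a + x * b = 0 := by linear_combination -y * hx + x * hy
  refine ⟨⟨!![s, t; -y, x], by rw [Matrix.det_fin_two_of]; linarith⟩, ?_⟩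
  refine Prod.ext ?_ ?_
  · have h₁ : ((s * a + t * b : ℤ) : ZMod n) = (g : ZMod n) :=
      congrArg _ (by linear_combination -bezout)
    simpa [sl2Smul, g] using h₁
  · simpa [sl2Smul] using congrArg (Int.cast : ℤ → ZMod n) hrow

lemma exists_sl2Smul_eq_gInv (n : ℕ) [NeZero n] (v : ZMod n × ZMod n) :
    ∃ M : Matrix.SpecialLinearGroup (Fin 2) ℤ, sl2Smul n M v = ((gInv n v : ZMod n), 0) := by
  obtain ⟨a, b, rfl⟩ := exists_intCast_pair n v
  obtain ⟨M, hM⟩ := exists_sl2Smul_intCast_eq_gcd n a b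
  -- modulo `n`, the pair `(gcd a b, 0)` also lifts to `(gcd a b, n)`
  obtain ⟨N, hN⟩ := exists_sl2Smul_intCast_eq_gcd n (Int.gcd a b) n
  refine ⟨N * M, ?_⟩
  rw [sl2Smul_mul, hM, gInv_intCast]
  simpa [Int.gcd_natCast_natCast] using hN

lemma gInv_dvd (n : ℕ) (v : ZMod n × ZMod n) : gInv n v ∣ n :=
  (Nat.gcd_dvd_right _ _).trans (Nat.gcd_dvd_right _ _)

lemma gInv_lt (n : ℕ) [NeZero n] {v : ZMod n × ZMod n} (hv : v ≠ (0, 0)) : gInv n v < n := by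
  refine lt_of_le_of_ne (Nat.le_of_dvd (NeZero.pos n) (gInv_dvd n v)) fun h => hv ?_
  obtain ⟨M, hM⟩ := exists_sl2Smul_eq_gInv n v
  rw [h, ZMod.natCast_self] at hM
  rw [← sl2Smul_one n v, ← inv_mul_cancel M, sl2Smul_mul, hM]
  simp [sl2Smul]

lemma gInv_natCast_zero (n : ℕ) [NeZero n] {d : ℕ} (hd : d ∣ n) :
    gInv n ((d : ZMod n), 0) = d := by
  have h := gInv_intCast n d 0
  simpa [Nat.gcd_eq_left hd] using h

theorem sl2_orbits_on_nonzero_biject_with_proper_divisors (n : ℕ) (hn : 0 < n) :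
    ∃ e : Quotient (sl2OrbitSetoidNonzero n) ≃ {d : ℕ // 0 < d ∧ d ∣ n ∧ d < n},
      ∀ v : {v : ZMod n × ZMod n // v ≠ ((0 : ZMod n), (0 : ZMod n))},
        (e (Quotient.mk (sl2OrbitSetoidNonzero n) v)).1 = gInv n v.1 := by
  have : NeZero n := ⟨hn.ne'⟩
  let f : Quotient (sl2OrbitSetoidNonzero n) → {d : ℕ // 0 < d ∧ d ∣ n ∧ d < n} :=
    Quotient.lift
      (fun v => ⟨gInv n v.1, Nat.pos_of_dvd_of_pos (gInv_dvd n v.1) hn, gInv_dvd n v.1,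
        gInv_lt n v.2⟩)
      (by
        rintro v w ⟨M, hM⟩
        exact Subtype.ext ((gInv_sl2Smul n M v.1).symm.trans (congrArg (gInv n) hM)))
  refine ⟨Equiv.ofBijective f ⟨?_, ?_⟩, fun v => rfl⟩
  · rintro ⟨v⟩ ⟨w⟩ h
    have hvw : gInv n v.1 = gInv n w.1 := congrArg Subtype.val h
    obtain ⟨M, hM⟩ := exists_sl2Smul_eq_gInv n v.1
    obtain ⟨N, hN⟩ := exists_sl2Smul_eq_gInv n w.1
    refine Quotient.sound ⟨N⁻¹ * M, ?_⟩
    rw [sl2Smul_mul, hM, hvw, ← hN, ← sl2Smul_mul, inv_mul_cancel, sl2Smul_one]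
  · rintro ⟨d, hd, hdn, hlt⟩
    have hne : ((d : ZMod n), (0 : ZMod n)) ≠ (0, 0) := fun h =>
      Nat.not_dvd_of_pos_of_lt hd hlt ((ZMod.natCast_eq_zero_iff d n).mp (congrArg Prod.fst h))
    exact ⟨Quotient.mk _ ⟨_, hne⟩, Subtype.ext (gInv_natCast_zero n hdn)⟩
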